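/- (Case I is impossible) There is no point x* ∈ Δ^7 with F†(x*) = α† such that f_1(x*) = f_2(x*) = f_3(x*) = α† and f_j(x*) < α† for every j ∈ {4,5,6,7,8}. -/

import Mathlib

noncomputable def sigD (t : ℝ) : ℝ := (1 - t) / t

def DeltaSeven : Set (Fin 8 → ℝ) := {x | (∀ i, 0 < x i) ∧ ∑ i, x i = 1}

noncomputable def fD (x : Fin 8 → ℝ) : Fin 8 → ℝ :=
  ![sigD (x 3 + x 4 + x 5) * sigD (x 0),
    sigD (x 3 + x 4 + x 5 + x 6 + x 7) * sigD (x 1),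
    sigD (x 0 + x 1 + x 2 + x 6 + x 7) * sigD (x 2),
    sigD (x 0 + x 1 + x 2) * sigD (x 3),
    sigD (x 0 + x 1 + x 2 + x 6 + x 7) * sigD (x 4),
    sigD (x 3 + x 4 + x 5 + x 6 + x 7) * sigD (x 5),
    sigD (x 3 + x 4 + x 5) * sigD (x 6),
    sigD (x 0 + x 1 + x 2) * sigD (x 7)]

noncomputable def FD (x : Fin 8 → ℝ) : ℝ :=
  Finset.univ.sup' Finset.univ_nonempty (fD x)

noncomputable def alphaD : ℝ := sInf (FD '' DeltaSeven)

open Filter Topology in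
lemma sig_cont (a u b v : ℝ) (ha : 0 < a) (hb : 0 < b) :
    Tendsto (fun t : ℝ => sigD (a + t * u) * sigD (b + t * v)) (𝓝[>] 0)
      (𝓝 (sigD a * sigD b)) := by
  have h : ContinuousAt (fun t : ℝ => sigD (a + t * u) * sigD (b + t * v)) 0 := by
    unfold sigD
    have h1 : a + 0 * u ≠ 0 := by simpa using ha.ne'
    have h2 : b + 0 * v ≠ 0 := by simpa using hb.ne'
    exact ContinuousAt.mul (ContinuousAt.div (by fun_prop) (by fun_prop) h1)
      (ContinuousAt.div (by fun_prop) (by fun_prop) h2)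
  have h3 := h.tendsto
  simp only [zero_mul, add_zero] at h3
  exact h3.mono_left nhdsWithin_le_nhds

open Filter Topology in
lemma sig_dec (a u b v : ℝ) (ha : 0 < a) (hb : 0 < b)
    (h : 0 < u * (b * (1 - b)) + v * (a * (1 - a))) :
    ∀ᶠ t : ℝ in 𝓝[>] 0, sigD (a + t * u) * sigD (b + t * v) < sigD a * sigD b := by
  have e1 : ∀ᶠ t : ℝ in 𝓝[>] 0, 0 < a + t * u := by
    have : Tendsto (fun t : ℝ => a + t * u) (𝓝 0) (𝓝 (a + 0 * u)) :=
      Continuous.tendsto (by fun_prop) 0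
    exact (this.mono_left nhdsWithin_le_nhds).eventually (lt_mem_nhds (by simpa using ha))
  have e2 : ∀ᶠ t : ℝ in 𝓝[>] 0, 0 < b + t * v := by
    have : Tendsto (fun t : ℝ => b + t * v) (𝓝 0) (𝓝 (b + 0 * v)) :=
      Continuous.tendsto (by fun_prop) 0
    exact (this.mono_left nhdsWithin_le_nhds).eventually (lt_mem_nhds (by simpa using hb))
  have e3 : ∀ᶠ t : ℝ in 𝓝[>] 0,
      0 < u * (b * (1 - b)) + v * (a * (1 - a)) + t * (u * v * (1 - a - b)) := by
    have : Tendsto (fun t : ℝ => u * (b * (1 - b)) + v * (a * (1 - a)) + t * (u * v * (1 - a - b)))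
      (𝓝 0) (𝓝 (u * (b * (1 - b)) + v * (a * (1 - a)) + 0 * (u * v * (1 - a - b)))) :=
      Continuous.tendsto (by fun_prop) 0
    exact (this.mono_left nhdsWithin_le_nhds).eventually (lt_mem_nhds (by simpa using h))
  filter_upwards [e1, e2, e3, self_mem_nhdsWithin] with t h1 h2 h3 h4
  have h4 : 0 < t := h4
  unfold sigD
  rw [div_mul_div_comm, div_mul_div_comm, div_lt_div_iff₀ (by positivity) (by positivity)]
  have := mul_pos h4 h3
  linarith

lemma sig_pos (a : ℝ) (h : 0 < a) (h' : a < 1) : 0 < sigD a :=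
  div_pos (by linarith) h

lemma FD_bdd : BddBelow (FD '' DeltaSeven) := by
  refine ⟨0, ?_⟩
  rintro _ ⟨x, ⟨hp, hs⟩, rfl⟩
  simp only [Fin.sum_univ_eight] at hs
  have h0 := hp 0
  have h1 := hp 1
  have h2 := hp 2
  have h3 := hp 3
  have h4 := hp 4
  have h5 := hp 5
  have h6 := hp 6
  have h7 := hp 7
  have : fD x 0 ≤ FD x := Finset.le_sup' (fD x) (Finset.mem_univ 0)
  refine le_trans ?_ this
  exact (mul_pos (sig_pos _ (by linarith) (by linarith)) (sig_pos _ h0 (by linarith))).le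

open Filter Topology in
lemma descent (x : Fin 8 → ℝ) (hx : x ∈ DeltaSeven)
    (g0 : fD x 0 = alphaD) (g1 : fD x 1 = alphaD) (g2 : fD x 2 = alphaD)
    (g3 : fD x 3 < alphaD) (g4 : fD x 4 < alphaD) (g5 : fD x 5 < alphaD)
    (g6 : fD x 6 < alphaD) (g7 : fD x 7 < alphaD)
    (p q r s : ℝ)
    (c0 : 0 < s * (x 0 * (1 - x 0)) + p * ((x 3 + x 4 + x 5) * (1 - (x 3 + x 4 + x 5))))
    (c1 : 0 < -(p + q + r) * (x 1 * (1 - x 1)) + q * ((x 0 + x 1 + x 2) * (1 - (x 0 + x 1 + x 2))))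
    (c2 : 0 < -s * (x 2 * (1 - x 2)) + r * ((x 3 + x 4 + x 5) * (1 - (x 3 + x 4 + x 5)))) :
    False := by
  obtain ⟨hp, hs⟩ := hx
  simp only [Fin.sum_univ_eight] at hs
  have h0 := hp 0
  have h1 := hp 1
  have h2 := hp 2
  have h3 := hp 3
  have h4 := hp 4
  have h5 := hp 5
  have h6 := hp 6
  have h7 := hp 7
  have eB : 1 - (x 3 + x 4 + x 5) = x 0 + x 1 + x 2 + x 6 + x 7 := by linarith
  have eA : 1 - (x 0 + x 1 + x 2) = x 3 + x 4 + x 5 + x 6 + x 7 := by linarith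
  set d : Fin 8 → ℝ := ![p, q, r, s, 0, 0, -(p + q + r + s), 0] with hd
  have d0 : d 0 = p := rfl
  have d1 : d 1 = q := rfl
  have d2 : d 2 = r := rfl
  have d3 : d 3 = s := rfl
  have d4 : d 4 = 0 := rfl
  have d5 : d 5 = 0 := rfl
  have d6 : d 6 = -(p + q + r + s) := rfl
  have d7 : d 7 = 0 := rfl
  have k0 := sig_dec (x 3 + x 4 + x 5) (d 3 + d 4 + d 5) (x 0) (d 0) (by linarith) h0 (by
    rw [d0, d3, d4, d5]; linarith)
  have k1 := sig_dec (x 3 + x 4 + x 5 + x 6 + x 7) (d 3 + d 4 + d 5 + d 6 + d 7) (x 1) (d 1)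
    (by linarith) h1 (by
      rw [d1, d3, d4, d5, d6, d7, ← eA]; linarith)
  have k2 := sig_dec (x 0 + x 1 + x 2 + x 6 + x 7) (d 0 + d 1 + d 2 + d 6 + d 7) (x 2) (d 2)
    (by linarith) h2 (by
      rw [d0, d1, d2, d6, d7, ← eB]; linarith)
  have k3 := (sig_cont (x 0 + x 1 + x 2) (d 0 + d 1 + d 2) (x 3) (d 3)
    (by linarith) h3).eventually (gt_mem_nhds g3)
  have k4 := (sig_cont (x 0 + x 1 + x 2 + x 6 + x 7) (d 0 + d 1 + d 2 + d 6 + d 7) (x 4) (d 4)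
    (by linarith) h4).eventually (gt_mem_nhds g4)
  have k5 := (sig_cont (x 3 + x 4 + x 5 + x 6 + x 7) (d 3 + d 4 + d 5 + d 6 + d 7) (x 5) (d 5)
    (by linarith) h5).eventually (gt_mem_nhds g5)
  have k6 := (sig_cont (x 3 + x 4 + x 5) (d 3 + d 4 + d 5) (x 6) (d 6)
    (by linarith) h6).eventually (gt_mem_nhds g6)
  have k7 := (sig_cont (x 0 + x 1 + x 2) (d 0 + d 1 + d 2) (x 7) (d 7)
    (by linarith) h7).eventually (gt_mem_nhds g7)
  have kp : ∀ᶠ t : ℝ in 𝓝[>] 0, ∀ i, 0 < x i + t * d i := by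
    rw [eventually_all]
    intro i
    have : Tendsto (fun t : ℝ => x i + t * d i) (𝓝 0) (𝓝 (x i + 0 * d i)) :=
      Continuous.tendsto (by fun_prop) 0
    exact (this.mono_left nhdsWithin_le_nhds).eventually (lt_mem_nhds (by simpa using hp i))
  obtain ⟨t, k0, k1, k2, k3, k4, k5, k6, k7, kp⟩ := (k0.and <| k1.and <| k2.and <| k3.and <|
    k4.and <| k5.and <| k6.and <| k7.and kp).exists
  have k0 := k0.trans_eq g0
  have k1 := k1.trans_eq g1
  have k2 := k2.trans_eq g2
  have hy : (fun i => x i + t * d i) ∈ DeltaSeven := by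
    refine ⟨kp, ?_⟩
    simp only [Fin.sum_univ_eight]
    rw [d0, d1, d2, d3, d4, d5, d6, d7]
    linarith
  have hle : alphaD ≤ FD (fun i => x i + t * d i) := csInf_le FD_bdd ⟨_, hy, rfl⟩
  have hlt : FD (fun i => x i + t * d i) < alphaD := by
    unfold FD
    rw [Finset.sup'_lt_iff]
    intro i _
    clear_value d
    fin_cases i
    · refine lt_of_eq_of_lt (congrArg₂ (fun a b => sigD a * sigD b) ?_ rfl) k0; ring
    · refine lt_of_eq_of_lt (congrArg₂ (fun a b => sigD a * sigD b) ?_ rfl) k1; ring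
    · refine lt_of_eq_of_lt (congrArg₂ (fun a b => sigD a * sigD b) ?_ rfl) k2; ring
    · refine lt_of_eq_of_lt (congrArg₂ (fun a b => sigD a * sigD b) ?_ rfl) k3; ring
    · refine lt_of_eq_of_lt (congrArg₂ (fun a b => sigD a * sigD b) ?_ rfl) k4; ring
    · refine lt_of_eq_of_lt (congrArg₂ (fun a b => sigD a * sigD b) ?_ rfl) k5; ring
    · refine lt_of_eq_of_lt (congrArg₂ (fun a b => sigD a * sigD b) ?_ rfl) k6; ring
    · refine lt_of_eq_of_lt (congrArg₂ (fun a b => sigD a * sigD b) ?_ rfl) k7; ring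
  linarith

theorem stmt7 :
    ¬ ∃ x ∈ DeltaSeven, FD x = alphaD ∧
      fD x 0 = alphaD ∧ fD x 1 = alphaD ∧ fD x 2 = alphaD ∧
      fD x 3 < alphaD ∧ fD x 4 < alphaD ∧ fD x 5 < alphaD ∧
      fD x 6 < alphaD ∧ fD x 7 < alphaD := by
  rintro ⟨x, hx, -, g0, g1, g2, g3, g4, g5, g6, g7⟩
  have key := descent x hx g0 g1 g2 g3 g4 g5 g6 g7
  obtain ⟨hp, hs⟩ := hx
  simp only [Fin.sum_univ_eight] at hs
  have h0 := hp 0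
  have h1 := hp 1
  have h2 := hp 2
  have h3 := hp 3
  have h4 := hp 4
  have h5 := hp 5
  have h6 := hp 6
  have h7 := hp 7
  have hSB : 0 < (x 3 + x 4 + x 5) * (1 - (x 3 + x 4 + x 5)) :=
    mul_pos (by linarith) (by linarith)
  set SB := (x 3 + x 4 + x 5) * (1 - (x 3 + x 4 + x 5)) with hSBd
  by_cases hk : (x 0 + x 1 + x 2) * (1 - (x 0 + x 1 + x 2)) - x 1 * (1 - x 1) = 0
  · have hA : x 0 + x 1 + x 2 + x 1 = 1 := by
      have : (x 0 + x 2) * (1 - (x 0 + x 1 + x 2 + x 1)) = 0 := by linarith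
      rcases mul_eq_zero.1 this with h | h <;> linarith
    have h02 : x 2 < x 0 := by
      by_contra hcon
      have hcon : x 0 ≤ x 2 := not_lt.1 hcon
      have e : sigD (x 3 + x 4 + x 5) * sigD (x 0)
        = sigD (x 0 + x 1 + x 2 + x 6 + x 7) * sigD (x 2) := g0.trans g2.symm
      have b1 : 1 < sigD (x 3 + x 4 + x 5) := by
        unfold sigD
        rw [lt_div_iff₀ (by linarith)]; linarith
      have b2 : sigD (x 0 + x 1 + x 2 + x 6 + x 7) < 1 := by
        unfold sigD
        rw [div_lt_one (by linarith)]; linarith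
      have p0 := sig_pos (x 0) h0 (by linarith)
      have p2 := sig_pos (x 2) h2 (by linarith)
      have b3 : sigD (x 2) ≤ sigD (x 0) := by
        unfold sigD
        rw [div_le_div_iff₀ h2 h0]; linarith
      nlinarith
    have hPR : x 2 * (1 - x 2) < x 0 * (1 - x 0) := by
      have : 0 < (x 0 - x 2) * (1 - x 0 - x 2) := mul_pos (by linarith) (by linarith)
      linarith
    have hQ : 0 < x 1 * (1 - x 1) := mul_pos h1 (by linarith)
    set P := x 0 * (1 - x 0)
    set R := x 2 * (1 - x 2)
    set Q := x 1 * (1 - x 1)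
    refine key (-P + (P - R) / 3) 0 (R + (P - R) / 3) SB ?_ ?_ ?_
    · have := mul_pos (sub_pos.2 hPR) hSB
      linarith
    · have := mul_pos (sub_pos.2 hPR) hQ
      linarith
    · have := mul_pos (sub_pos.2 hPR) hSB
      linarith
  · set SA := (x 0 + x 1 + x 2) * (1 - (x 0 + x 1 + x 2))
    set Q := x 1 * (1 - x 1)
    have hk2 : 0 < (SA - Q) ^ 2 := by positivity
    refine key ((SA - Q) ^ 2) ((SA - Q) * (2 * Q + 1)) ((SA - Q) ^ 2) 0 ?_ ?_ ?_
    · have := mul_pos hk2 hSB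
      linarith
    · linarith
    · have := mul_pos hk2 hSB
      linarith
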